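/- The unit group of the ring of integers of $\mathbb{Q}(\zeta_8)$ is generated by $\zeta_8$ and $1 + \sqrt{2}$, i.e., $E_K = \langle \zeta_8, 1+\sqrt{2} \rangle$. -/

import Mathlib

open NumberField

theorem aux_cyc (K : Type) [Field K] [NumberField K]
    (ζ : K) (hζ : IsPrimitiveRoot ζ 8) (hgen : Algebra.adjoin ℚ {ζ} = ⊤) :
    IsCyclotomicExtension {2 ^ 3} ℚ K := by
  rw [IsCyclotomicExtension.iff_adjoin_eq_top]
  refine ⟨?_, ?_⟩
  · rintro n hn -
    rw [Set.mem_singleton_iff] at hn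
    subst hn
    exact ⟨ζ, by simpa using hζ⟩
  · rw [eq_top_iff, ← hgen]
    apply Algebra.adjoin_mono
    rintro x hx
    rw [Set.mem_singleton_iff] at hx
    subst hx
    exact ⟨2 ^ 3, rfl, by norm_num, by simpa using hζ.pow_eq_one⟩

theorem aux_basis (K : Type) [Field K] [NumberField K]
    [IsCyclotomicExtension {2 ^ 3} ℚ K]
    (z : 𝓞 K) (hz : IsPrimitiveRoot z 8) :
    ∃ B : Module.Basis (Fin 4) ℤ (𝓞 K), ∀ i, B i = z ^ (i : ℕ) := by
  have : Fact (Nat.Prime 2) := ⟨Nat.prime_two⟩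
  have hz' : IsPrimitiveRoot (z : K) (2 ^ 3) := by
    have := hz.map_of_injective (f := algebraMap (𝓞 K) K) RingOfIntegers.coe_injective
    simpa using this
  have hd : hz'.integralPowerBasisOfPrimePow.dim = 4 := by
    rw [hz'.integralPowerBasisOfPrimePow_dim]; decide
  refine ⟨hz'.integralPowerBasisOfPrimePow.basis.reindex (finCongr hd), fun i => ?_⟩
  simp

theorem aux_norm (a b c d a' b' c' d' : ℤ)
    (h0 : a * a' - b * d' - c * c' - d * b' = 1)
    (h1 : a * b' + b * a' - c * d' - d * c' = 0)
    (h2 : a * c' + b * b' + c * a' - d * d' = 0)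
    (h3 : a * d' + b * c' + c * b' + d * a' = 0) :
    (a^2+b^2+c^2+d^2)^2 - 2 * (a*b+b*c+c*d-d*a)^2 = 1 := by
  have key : ((a^2+b^2+c^2+d^2)^2 - 2 * (a*b+b*c+c*d-d*a)^2) *
      ((a'^2+b'^2+c'^2+d'^2)^2 - 2 * (a'*b'+b'*c'+c'*d'-d'*a')^2) = 1 := by
    have : ((a^2+b^2+c^2+d^2)^2 - 2 * (a*b+b*c+c*d-d*a)^2) *
      ((a'^2+b'^2+c'^2+d'^2)^2 - 2 * (a'*b'+b'*c'+c'*d'-d'*a')^2) =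
      (((a * a' - b * d' - c * c' - d * b')^2 + (a * b' + b * a' - c * d' - d * c')^2
        + (a * c' + b * b' + c * a' - d * d')^2 + (a * d' + b * c' + c * b' + d * a')^2)^2
        - 2 * ((a * a' - b * d' - c * c' - d * b') * (a * b' + b * a' - c * d' - d * c')
         + (a * b' + b * a' - c * d' - d * c') * (a * c' + b * b' + c * a' - d * d')
         + (a * c' + b * b' + c * a' - d * d') * (a * d' + b * c' + c * b' + d * a')
         - (a * d' + b * c' + c * b' + d * a') * (a * a' - b * d' - c * c' - d * b'))^2) := by
      ring
    rw [this, h0, h1, h2, h3]; norm_num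
  have hpos : 0 ≤ (a^2+b^2+c^2+d^2)^2 - 2 * (a*b+b*c+c*d-d*a)^2 := by
    have : (a^2+b^2+c^2+d^2)^2 - 2 * (a*b+b*c+c*d-d*a)^2 =
      (a^2-c^2+2*b*d)^2 + (2*a*c-b^2+d^2)^2 := by ring
    rw [this]; positivity
  rcases Int.eq_one_or_neg_one_of_mul_eq_one key with h | h
  · exact h
  · omega

/-- Descent on `P = a² + b² + c² + d²`. -/
theorem aux_descent {R : Type} [CommRing R] (z : R) (h4 : z ^ 4 = -1) (H : Subgroup Rˣ)
    (u e1 e2 : Rˣ) (hu : (u : R) = z) (huH : u ∈ H) (h1 : (e1 : R) = 1 + (z - z ^ 3))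
    (h1H : e1 ∈ H) (h2 : (e2 : R) = 1 - (z - z ^ 3)) (h2H : e2 ∈ H) (n : ℕ) :
    ∀ (a b c d : ℤ) (w : Rˣ), (w : R) = a + b * z + c * z ^ 2 + d * z ^ 3 →
      (a^2+b^2+c^2+d^2)^2 - 2 * (a*b+b*c+c*d-d*a)^2 = 1 →
      a^2+b^2+c^2+d^2 ≤ n → w ∈ H := by
  induction n with
  | zero =>
    intro a b c d w hw hN hn
    have hP : a^2+b^2+c^2+d^2 = 0 := le_antisymm (by simpa using hn) (by positivity)
    rw [hP] at hN
    nlinarith [sq_nonneg (a*b+b*c+c*d-d*a)]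
  | succ n ih =>
    intro a b c d w hw hN hn
    push_cast at hn
    have hP0 : 0 ≤ a^2+b^2+c^2+d^2 := by positivity
    rcases lt_trichotomy (a*b+b*c+c*d-d*a) 0 with hQ | hQ | hQ
    · have hlt : a^2+b^2+c^2+d^2 < -2 * (a*b+b*c+c*d-d*a) := by nlinarith
      have hm : w * e1 ∈ H := by
        refine ih (a + (b-d)) (b + (a+c)) (c + (b+d)) (d + (c-a)) (w * e1) ?_ ?_ ?_
        · rw [Units.val_mul, hw, h1]; push_cast
          linear_combination (-b + d * (1 - z ^ 2) - c * z) * h4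
        · rw [← hN]; ring
        · have : (a + (b-d))^2 + (b + (a+c))^2 + (c + (b+d))^2 + (d + (c-a))^2 =
            3 * (a^2+b^2+c^2+d^2) + 4 * (a*b+b*c+c*d-d*a) := by ring
          rw [this]; linarith
      exact (Subgroup.mul_mem_cancel_right H h1H).1 hm
    · have hP : a^2+b^2+c^2+d^2 = 1 := by
        rw [hQ] at hN; nlinarith
      have hneg : (-1 : Rˣ) ∈ H := by
        have : (-1 : Rˣ) = u ^ 4 := by ext; simp [hu, h4]
        rw [this]; exact H.pow_mem huH 4
      have hun : ∀ k : ℕ, ((w : R) = z ^ k ∨ (w : R) = - z ^ k) → w ∈ H := by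
        rintro k (h | h)
        · have : w = u ^ k := by ext; simp [hu, h]
          rw [this]; exact H.pow_mem huH k
        · have : w = -1 * u ^ k := by ext; simp [hu, h]
          rw [this]; exact H.mul_mem hneg (H.pow_mem huH k)
      have ha : -1 ≤ a ∧ a ≤ 1 := by constructor <;> nlinarith [sq_nonneg b, sq_nonneg c, sq_nonneg d]
      have hb : -1 ≤ b ∧ b ≤ 1 := by constructor <;> nlinarith [sq_nonneg a, sq_nonneg c, sq_nonneg d]
      have hc : -1 ≤ c ∧ c ≤ 1 := by constructor <;> nlinarith [sq_nonneg b, sq_nonneg a, sq_nonneg d]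
      have hd : -1 ≤ d ∧ d ≤ 1 := by constructor <;> nlinarith [sq_nonneg b, sq_nonneg c, sq_nonneg a]
      obtain ⟨ha1, ha2⟩ := ha
      obtain ⟨hb1, hb2⟩ := hb
      obtain ⟨hc1, hc2⟩ := hc
      obtain ⟨hd1, hd2⟩ := hd
      clear hN hn ih hP0 hQ
      interval_cases a <;> interval_cases b <;> interval_cases c <;> interval_cases d <;>
        first
        | (exfalso; revert hP; norm_num; done)
        | (apply hun 0; rw [hw]; simp; done)
        | (apply hun 1; rw [hw]; simp; done)
        | (apply hun 2; rw [hw]; simp; done)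
        | (apply hun 3; rw [hw]; simp; done)
    · have hlt : a^2+b^2+c^2+d^2 < 2 * (a*b+b*c+c*d-d*a) := by nlinarith
      have hm : w * e2 ∈ H := by
        refine ih (a - (b-d)) (b - (a+c)) (c - (b+d)) (d - (c-a)) (w * e2) ?_ ?_ ?_
        · rw [Units.val_mul, hw, h2]; push_cast
          linear_combination (b - d * (1 - z ^ 2) + c * z) * h4
        · rw [← hN]; ring
        · have : (a - (b-d))^2 + (b - (a+c))^2 + (c - (b+d))^2 + (d - (c-a))^2 =
            3 * (a^2+b^2+c^2+d^2) - 4 * (a*b+b*c+c*d-d*a) := by ring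
          rw [this]; linarith
      exact (Subgroup.mul_mem_cancel_right H h2H).1 hm

/-- The unit group of the ring of integers of `K = ℚ(ζ₈)` is generated by `ζ₈` and `1 + √2`. -/
theorem stmt_6 (K : Type) [Field K] [NumberField K]
    (ζ : K) (hζ : IsPrimitiveRoot ζ 8) (hgen : Algebra.adjoin ℚ {ζ} = ⊤)
    (z e : 𝓞 K) (hz : IsPrimitiveRoot z 8)
    (sqrt2 : 𝓞 K) (hsqrt2 : sqrt2 ^ 2 = 2) (he : e = 1 + sqrt2)
    (u v : (𝓞 K)ˣ) (hu : (u : 𝓞 K) = z) (hv : (v : 𝓞 K) = e) :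
    Subgroup.closure {u, v} = (⊤ : Subgroup (𝓞 K)ˣ) := by
  have := aux_cyc K ζ hζ hgen
  obtain ⟨B, hB⟩ := aux_basis K z hz
  have h4 : z ^ 4 = -1 := by
    have h8 : (z ^ 4 - 1) * (z ^ 4 + 1) = 0 := by
      linear_combination hz.pow_eq_one
    rcases mul_eq_zero.1 h8 with h | h
    · exact absurd (sub_eq_zero.1 h) (hz.pow_ne_one_of_pos_of_lt (by norm_num) (by norm_num))
    · exact eq_neg_of_add_eq_zero_left h
  set H := Subgroup.closure {u, v} with hH
  have huH : u ∈ H := Subgroup.subset_closure (by simp)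
  have hvH : v ∈ H := Subgroup.subset_closure (by simp)
  have hneg : (-1 : (𝓞 K)ˣ) ∈ H := by
    have : (-1 : (𝓞 K)ˣ) = u ^ 4 := by ext; simp [hu, h4]
    rw [this]; exact H.pow_mem huH 4
  -- the conjugate unit
  have hv1 : (v : 𝓞 K) * (sqrt2 - 1) = 1 := by
    rw [hv, he]; linear_combination hsqrt2
  have hvinv : ((v⁻¹ : (𝓞 K)ˣ) : 𝓞 K) = sqrt2 - 1 := Units.inv_eq_of_mul_eq_one_right hv1
  have hv2 : ((-1 * v⁻¹ : (𝓞 K)ˣ) : 𝓞 K) = 1 - sqrt2 := by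
    rw [Units.val_mul, hvinv]; simp
  have hv2H : -1 * v⁻¹ ∈ H := H.mul_mem hneg (H.inv_mem hvH)
  have hs : sqrt2 = z - z ^ 3 ∨ sqrt2 = -(z - z ^ 3) := by
    apply sq_eq_sq_iff_eq_or_eq_neg.1
    rw [hsqrt2]; linear_combination (2 - z ^ 2) * h4
  have hE : ∃ e1 e2 : (𝓞 K)ˣ, e1 ∈ H ∧ e2 ∈ H ∧ (e1 : 𝓞 K) = 1 + (z - z ^ 3) ∧
      (e2 : 𝓞 K) = 1 - (z - z ^ 3) := by
    rcases hs with h | h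
    · exact ⟨v, -1 * v⁻¹, hvH, hv2H, by rw [hv, he, h], by rw [hv2, h]⟩
    · exact ⟨-1 * v⁻¹, v, hv2H, hvH, by rw [hv2, h]; ring, by rw [hv, he, h]; ring⟩
  obtain ⟨e1, e2, h1H, h2H, h1, h2⟩ := hE
  have hrep : ∀ x : 𝓞 K, ∃ a b c d : ℤ, x = a + b * z + c * z ^ 2 + d * z ^ 3 := by
    intro x
    refine ⟨B.repr x 0, B.repr x 1, B.repr x 2, B.repr x 3, ?_⟩
    conv_lhs => rw [← B.sum_repr x]
    simp [Fin.sum_univ_four, hB]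
  have hind : ∀ a b c d : ℤ, (a : 𝓞 K) + b * z + c * z ^ 2 + d * z ^ 3 = 0 →
      a = 0 ∧ b = 0 ∧ c = 0 ∧ d = 0 := by
    intro a b c d h
    have := Fintype.linearIndependent_iff.1 B.linearIndependent ![a, b, c, d]
      (by simpa [Fin.sum_univ_four, hB] using h)
    exact ⟨this 0, this 1, this 2, this 3⟩
  rw [eq_top_iff]
  rintro w -
  obtain ⟨a, b, c, d, hw⟩ := hrep w
  obtain ⟨a', b', c', d', hw'⟩ := hrep ((w⁻¹ : (𝓞 K)ˣ) : 𝓞 K)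
  have hmul : (w : 𝓞 K) * ((w⁻¹ : (𝓞 K)ˣ) : 𝓞 K) = 1 := by simp
  rw [hw, hw'] at hmul
  obtain ⟨k0, k1, k2, k3⟩ := hind (a * a' - b * d' - c * c' - d * b' - 1)
    (a * b' + b * a' - c * d' - d * c') (a * c' + b * b' + c * a' - d * d')
    (a * d' + b * c' + c * b' + d * a') (by
      push_cast
      linear_combination hmul - (b * d' + c * c' + d * b' + (c * d' + d * c') * z
        + d * d' * z ^ 2 : 𝓞 K) * h4)
  have hN := aux_norm a b c d a' b' c' d' (by linarith) k1 k2 k3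
  refine aux_descent z h4 H u e1 e2 hu huH h1 h1H h2 h2H
    (a^2+b^2+c^2+d^2).toNat a b c d w hw hN ?_
  exact Int.self_le_toNat _
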